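/- arXiv:1408.6322 — 2 statements merged into one kernel-verified Lean document; each statement's English description precedes it below -/
import Mathlib

section
/- Let u : ℝⁿ → ℝ be 1-Lipschitz and let ε₀ > 0. Then u is differentiable at every point of Strain_{ε₀}[u], and there exists a function ũ : ℝⁿ → ℝ which is C¹ with locally Lipschitz gradient (a C^{1,1}-function) such that for every x ∈ Strain_{ε₀}[u] one has ũ(x) = u(x) and ∇ũ(x) = ∇u(x). (Euclidean case of the C^{1,1}-regularity of a Kantorovich potential on its strain set.) -/
/-- The set `Strain_ε[u]` of `ε`-strain points of a function `u` on `ℝⁿ`. -/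
def strainEps {n : ℕ} (u : EuclideanSpace ℝ (Fin n) → ℝ) (ε : ℝ) :
    Set (EuclideanSpace ℝ (Fin n)) :=
  {y | ∃ x z : EuclideanSpace ℝ (Fin n), u y - u x = ‖x - y‖ ∧ ε < ‖x - y‖ ∧
    u z - u y = ‖y - z‖ ∧ ε < ‖y - z‖ ∧ ‖x - z‖ = ‖x - y‖ + ‖y - z‖}

open Set Filter Topology InnerProductSpace

theorem c11_hasGradientAt_of_quad {E : Type*} [NormedAddCommGroup E] [InnerProductSpace ℝ E]
    [CompleteSpace E] {v : E → ℝ} {M : ℝ} {x q : E}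
    (h : ∀ d, |v (x + d) - v x - inner ℝ q d| ≤ M * ‖d‖ ^ 2) : HasGradientAt v q x := by
  rw [hasGradientAt_iff_isLittleO_nhds_zero]
  have h1 : (fun d => v (x + d) - v x - inner ℝ q d) =O[𝓝 0] (fun d : E => ‖d‖ ^ 2) := by
    refine Asymptotics.IsBigO.of_bound M (Eventually.of_forall fun d => ?_)
    simpa using h d
  refine h1.trans_isLittleO ?_
  have := Asymptotics.isLittleO_pow_id (𝕜 := ℝ) (n := 2) (by norm_num)
  have h2 := this.comp_tendsto (tendsto_norm_zero (E := E))
  exact (h2.trans_isBigO (Asymptotics.isBigO_refl _ _)).norm_right.trans_isBigO (by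
    refine Asymptotics.IsBigO.of_bound 1 (Eventually.of_forall fun d => ?_)
    simp)

theorem c11_of_quad {E : Type*} [NormedAddCommGroup E] [InnerProductSpace ℝ E]
    [CompleteSpace E] {v : E → ℝ} {M : ℝ} (hM : 0 ≤ M)
    (h : ∀ x, ∃ q : E, ∀ d, |v (x + d) - v x - inner ℝ q d| ≤ M * ‖d‖ ^ 2) :
    ContDiff ℝ 1 v ∧ LocallyLipschitz (gradient v) := by
  choose q hq using h
  have hg : ∀ x, HasGradientAt v (q x) x := fun x => c11_hasGradientAt_of_quad (hq x)
  have hgq : gradient v = q := funext fun x => (hg x).gradient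
  have hL : LipschitzWith (6 * M).toNNReal q := by
    refine LipschitzWith.of_dist_le_mul fun x y => ?_
    rw [Real.coe_toNNReal _ (by positivity), dist_eq_norm, dist_eq_norm]
    by_cases he : q x - q y = 0
    · rw [he]; simp; positivity
    have hep : 0 < ‖q x - q y‖ := norm_pos_iff.mpr he
    by_cases hk : y - x = 0
    · rw [sub_eq_zero] at hk; simp [hk]
    have hkp : 0 < ‖y - x‖ := norm_pos_iff.mpr hk
    set e := q x - q y with hedef
    set k := y - x with hkdef
    set d : E := (‖k‖ / ‖e‖) • e with hd
    have hdn : ‖d‖ = ‖k‖ := by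
      rw [hd, norm_smul, Real.norm_of_nonneg (by positivity)]; field_simp
    have hin : inner ℝ (q x) d - inner ℝ (q y) d = ‖k‖ * ‖e‖ := by
      rw [← inner_sub_left, ← hedef, hd, inner_smul_right, real_inner_self_eq_norm_sq]; field_simp
    have h1 := hq x (k + d)
    have h2 := hq x k
    have h3 := hq y d
    have e1 : x + (k + d) = y + d := by rw [hkdef]; abel
    have e2 : x + k = y := by rw [hkdef]; abel
    rw [e1, inner_add_right] at h1
    rw [e2] at h2
    have hn : ‖k + d‖ ^ 2 ≤ (2 * ‖k‖) ^ 2 := by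
      have := norm_add_le k d
      rw [hdn] at this
      gcongr; linarith
    have hn' := mul_le_mul_of_nonneg_left hn hM
    rw [hdn] at h3
    rw [abs_le] at h1 h2 h3
    have hf : ‖k‖ * ‖e‖ ≤ ‖k‖ * (6 * M * ‖k‖) := by nlinarith
    have := le_of_mul_le_mul_left hf hkp
    rwa [norm_sub_rev x y]
  refine ⟨?_, hgq ▸ hL.locallyLipschitz⟩
  rw [contDiff_one_iff_fderiv]
  refine ⟨fun x => (hg x).differentiableAt, ?_⟩
  rw [← toDual_comp_gradient, hgq]
  exact (toDual ℝ E).continuous.comp hL.continuous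

theorem c11_subgradient {E : Type*} [NormedAddCommGroup E] [InnerProductSpace ℝ E]
    [FiniteDimensional ℝ E] {H : E → ℝ} (hH : ConvexOn ℝ univ H) (x : E) :
    ∃ g : E, ∀ d, H x + inner ℝ g d ≤ H (x + d) := by
  have : CompleteSpace E := FiniteDimensional.complete ℝ E
  have hc : Continuous H := by
    have := hH.continuousOn isOpen_univ
    rwa [continuousOn_univ] at this
  have hconv := hH.convex_strict_epigraph
  have hopen : IsOpen {p : E × ℝ | p.1 ∈ (univ : Set E) ∧ H p.1 < p.2} := by
    simp only [mem_univ, true_and]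
    exact isOpen_lt (hc.comp continuous_fst) continuous_snd
  obtain ⟨f, hf⟩ := geometric_hahn_banach_open_point hconv hopen
    (x := (x, H x)) (by simp)
  set b := f (0, 1) with hb
  have hdec : ∀ w t, f (w, t) = f (w, 0) + t * b := by
    intro w t
    have : ((w, t) : E × ℝ) = (w, 0) + t • ((0 : E), (1 : ℝ)) := by simp
    rw [this, map_add, map_smul, smul_eq_mul]
  have hbneg : b < 0 := by
    have := hf (x, H x + 1) (by simp)
    rw [hdec, hdec x (H x)] at this
    linarith
  have hle : ∀ w, f (w, 0) + H w * b ≤ f (x, 0) + H x * b := by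
    intro w
    refine le_of_forall_pos_le_add fun δ hδ => ?_
    have := hf (w, H w + δ / (-b)) (by simpa using div_pos hδ (neg_pos.mpr hbneg))
    rw [hdec, hdec x (H x)] at this
    have e : δ / (-b) * b = -δ := by
      have hb0 : b ≠ 0 := hbneg.ne
      rw [div_neg, neg_mul, div_mul_cancel₀ _ hb0]
    nlinarith
  let l : E →L[ℝ] ℝ := (-b)⁻¹ • f.comp (ContinuousLinearMap.inl ℝ E ℝ)
  refine ⟨(toDual ℝ E).symm l, fun d => ?_⟩
  rw [toDual_symm_apply]
  have h1 := hle (x + d)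
  have h2 : f (x + d, 0) = f (x, 0) + f (d, 0) := by
    rw [← map_add]; simp
  have h3 : l d = (-b)⁻¹ * f (d, 0) := by simp [l]
  have hb' : 0 < -b := by linarith
  rw [h3, ← sub_nonneg]
  have : H (x + d) - (H x + (-b)⁻¹ * f (d, 0)) =
    (-b)⁻¹ * ((-b) * H (x + d) - (-b) * H x - f (d, 0)) := by
    have hb0 : -b ≠ 0 := hb'.ne'
    rw [mul_sub, mul_sub, inv_mul_cancel_left₀ hb0, inv_mul_cancel_left₀ hb0]
    ring
  rw [this]
  apply mul_nonneg (by positivity)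
  nlinarith

theorem c11_extension {E : Type*} [NormedAddCommGroup E] [InnerProductSpace ℝ E]
    [FiniteDimensional ℝ E] {S : Set E} {u : E → ℝ} {p : E → E} {K : ℝ} (hK : 0 ≤ K)
    (h : ∀ y ∈ S, ∀ w, |u w - u y - inner ℝ (p y) (w - y)| ≤ K * ‖w - y‖ ^ 2) :
    ∃ v : E → ℝ, (∀ x, ∃ q : E, ∀ d, |v (x + d) - v x - inner ℝ q d| ≤ 3 * K * ‖d‖ ^ 2) ∧
      ∀ y ∈ S, v y = u y ∧ ∀ w, |v w - v y - inner ℝ (p y) (w - y)| ≤ K * ‖w - y‖ ^ 2 := by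
  rcases S.eq_empty_or_nonempty with rfl | ⟨y₀, hy₀⟩
  · exact ⟨0, fun x => ⟨0, fun d => by simp; positivity⟩, by simp⟩
  let Q : E → E → ℝ := fun y w => u y + inner ℝ (p y) (w - y) + K * ‖w - y‖ ^ 2 + K * ‖w‖ ^ 2
  let A : E → E → ℝ := fun y w => u y + inner ℝ (p y) (w - y) - K * ‖w - y‖ ^ 2 + K * ‖w‖ ^ 2
  let Φ : Set (E → ℝ) := {φ | ConvexOn ℝ univ φ ∧ ∀ y ∈ S, ∀ w, φ w ≤ Q y w}
  let H : E → ℝ := fun w => sSup ((fun φ : E → ℝ => φ w) '' Φ)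
  have hbdd : ∀ w, BddAbove ((fun φ : E → ℝ => φ w) '' Φ) := by
    intro w
    refine ⟨Q y₀ w, ?_⟩
    rintro _ ⟨φ, hφ, rfl⟩
    exact hφ.2 y₀ hy₀ w
  have hle : ∀ φ ∈ Φ, ∀ w, φ w ≤ H w := fun φ hφ w => le_csSup (hbdd w) ⟨φ, hφ, rfl⟩
  have hA : ∀ y ∈ S, A y ∈ Φ := by
    intro y hy
    refine ⟨?_, fun y' hy' w => ?_⟩
    · have hAe : A y = fun w => (u y - inner ℝ (p y) y - K * ‖y‖ ^ 2)
          + inner ℝ (p y + (2 * K) • y) w := by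
        funext w
        simp only [A]
        rw [norm_sub_sq_real, inner_sub_right, inner_add_left, inner_smul_left, real_inner_comm y w]
        simp; ring
      rw [hAe]
      refine ⟨convex_univ, fun a _ b _ s t _ _ hst => ?_⟩
      simp only [inner_add_right, inner_smul_right, smul_eq_mul]
      generalize inner ℝ (p y + (2 * K) • y) a = X
      generalize inner ℝ (p y + (2 * K) • y) b = Y
      have : t = 1 - s := by linarith
      subst this
      apply le_of_eq; ring
    · have h1 := abs_le.mp (h y hy w)
      have h2 := abs_le.mp (h y' hy' w)
      simp only [A, Q]
      linarith
  have hne : ∀ w, ((fun φ : E → ℝ => φ w) '' Φ).Nonempty := fun w => ⟨_, A y₀, hA y₀ hy₀, rfl⟩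
  have hHQ : ∀ y ∈ S, ∀ w, H w ≤ Q y w := by
    intro y hy w
    apply csSup_le (hne w)
    rintro _ ⟨φ, hφ, rfl⟩
    exact hφ.2 y hy w
  have hconv : ConvexOn ℝ univ H := by
    refine ⟨convex_univ, fun a _ b _ s t hs ht hst => ?_⟩
    apply csSup_le (hne _)
    rintro _ ⟨φ, hφ, rfl⟩
    refine (hφ.1.2 (mem_univ a) (mem_univ b) hs ht hst).trans ?_
    have h1 := hle φ hφ a
    have h2 := hle φ hφ b
    simp only [smul_eq_mul]
    gcongr
  have hsemi : ∀ x d, H (x + d) + H (x - d) - 2 * H x ≤ 4 * K * ‖d‖ ^ 2 := by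
    intro x d
    let ψ : E → ℝ := fun w => (1/2) * (H (w + d) + H (w - d)) - 2 * K * ‖d‖ ^ 2
    have hψ : ψ ∈ Φ := by
      refine ⟨⟨convex_univ, fun a _ b _ s t hs ht hst => ?_⟩, fun y hy w => ?_⟩
      · have e1 : s • a + t • b + d = s • (a + d) + t • (b + d) := by
          have : d = (s + t) • d := by rw [hst, one_smul]
          nth_rw 1 [this]; module
        have e2 : s • a + t • b - d = s • (a - d) + t • (b - d) := by
          have : d = (s + t) • d := by rw [hst, one_smul]
          nth_rw 1 [this]; module
        have h1 := hconv.2 (mem_univ (a + d)) (mem_univ (b + d)) hs ht hst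
        have h2 := hconv.2 (mem_univ (a - d)) (mem_univ (b - d)) hs ht hst
        simp only [ψ, smul_eq_mul] at *
        rw [e1, e2]
        have : t = 1 - s := by linarith
        subst this
        linarith
      · have h1 := hHQ y hy (w + d)
        have h2 := hHQ y hy (w - d)
        have e1 : w + d - y = (w - y) + d := by abel
        have e2 : w - d - y = (w - y) - d := by abel
        simp only [ψ, Q] at *
        rw [e1, norm_add_sq_real, norm_add_sq_real, inner_add_right] at h1
        rw [e2, norm_sub_sq_real (w - y) d, norm_sub_sq_real w d, inner_sub_right _ _ d] at h2
        linarith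
    have := hle ψ hψ x
    simp only [ψ] at this
    linarith
  have hlow : ∀ y ∈ S, ∀ w, A y w ≤ H w := fun y hy w => hle _ (hA y hy) w
  refine ⟨fun w => H w - K * ‖w‖ ^ 2, fun x => ?_, fun y hy => ?_⟩
  · obtain ⟨g, hg⟩ := c11_subgradient hconv x
    refine ⟨g - (2 * K) • x, fun d => ?_⟩
    have h1 := hg d
    have h2 := hg (-d)
    have h3 := hsemi x d
    rw [inner_neg_right, ← sub_eq_add_neg, ← sub_eq_add_neg] at h2
    have hp : 0 ≤ K * ‖d‖ ^ 2 := by positivity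
    simp only
    rw [norm_add_sq_real, inner_sub_left, inner_smul_left, abs_le]
    simp only [conj_trivial]
    constructor <;> linarith
  · have h1 := hlow y hy y
    have h2 := hHQ y hy y
    simp only [A, Q, sub_self, inner_zero_right, norm_zero] at h1 h2
    have e : H y - K * ‖y‖ ^ 2 = u y := by
      norm_num at h1 h2; linarith
    refine ⟨e, fun w => ?_⟩
    have h3 := hlow y hy w
    have h4 := hHQ y hy w
    simp only [A, Q] at h3 h4
    simp only [e]
    rw [abs_le]
    constructor <;> linarith

theorem c11_norm_bound {E : Type*} [NormedAddCommGroup E] [InnerProductSpace ℝ E]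
    {p d : E} {a ε : ℝ} (hp : ‖p‖ = 1) (hε : 0 < ε) (ha : ε < a) :
    ‖d + a • p‖ ≤ a + inner ℝ p d + 1 / (2 * ε) * ‖d‖ ^ 2 := by
  have ha0 : 0 < a := hε.trans ha
  have h1 : ‖d + a • p‖ ^ 2 = ‖d‖ ^ 2 + 2 * (a * inner ℝ p d) + a ^ 2 := by
    rw [norm_add_sq_real, inner_smul_right, norm_smul, hp, real_inner_comm, mul_one,
      Real.norm_of_nonneg ha0.le]
  have h2 : ‖d + a • p‖ ≤ a + inner ℝ p d + 1 / (2 * a) * ‖d‖ ^ 2 := by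
    have : a + inner ℝ p d + 1 / (2 * a) * ‖d‖ ^ 2 = (‖d + a • p‖ ^ 2 + a ^ 2) / (2 * a) := by
      rw [h1]; field_simp; ring
    rw [this, le_div_iff₀ (by positivity)]
    nlinarith [sq_nonneg (‖d + a • p‖ - a)]
  have h3 : 1 / (2 * a) * ‖d‖ ^ 2 ≤ 1 / (2 * ε) * ‖d‖ ^ 2 := by gcongr
  linarith

theorem c11_strain {n : ℕ} (u : EuclideanSpace ℝ (Fin n) → ℝ)
    (hu : LipschitzWith 1 u) (ε₀ : ℝ) (hε₀ : 0 < ε₀) :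
    ∀ y ∈ strainEps u ε₀, ∃ p, ∀ w,
      |u w - u y - inner ℝ p (w - y)| ≤ 1 / (2 * ε₀) * ‖w - y‖ ^ 2 := by
  rintro y ⟨x, z, hx, hxε, hz, hzε, hxz⟩
  have ha : 0 < ‖x - y‖ := hε₀.trans hxε
  have hb : 0 < ‖y - z‖ := hε₀.trans hzε
  have hray : SameRay ℝ (x - y) (y - z) := by
    rw [sameRay_iff_norm_add, ← hxz]; congr 1; abel
  have hdir := (sameRay_iff_inv_norm_smul_eq_of_ne (norm_pos_iff.mp ha)
    (norm_pos_iff.mp hb)).mp hray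
  set a := ‖x - y‖ with had
  set b := ‖y - z‖ with hbd
  set p := a⁻¹ • (y - x) with hp
  have hpb : p = b⁻¹ • (z - y) := by
    rw [hp, ← neg_sub x y, ← neg_sub y z, smul_neg, smul_neg, hdir]
  have hp1 : ‖p‖ = 1 := by
    rw [hp, norm_smul, norm_sub_rev, ← had, norm_inv, Real.norm_of_nonneg ha.le]; field_simp
  have hax : a • p = y - x := by rw [hp, smul_smul, mul_inv_cancel₀ ha.ne', one_smul]
  have hbz : b • p = z - y := by rw [hpb, smul_smul, mul_inv_cancel₀ hb.ne', one_smul]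
  refine ⟨p, fun w => ?_⟩
  have l1 := hu.dist_le_mul w x
  have l2 := hu.dist_le_mul z w
  rw [Real.dist_eq, dist_eq_norm, NNReal.coe_one, one_mul] at l1 l2
  have b1 := c11_norm_bound (d := w - y) hp1 hε₀ hxε
  have b2 := c11_norm_bound (d := y - w) hp1 hε₀ hzε
  rw [hax] at b1
  rw [hbz] at b2
  have e1 : w - y + (y - x) = w - x := by abel
  have e2 : y - w + (z - y) = z - w := by abel
  rw [e1] at b1
  rw [e2, norm_sub_rev y w, ← neg_sub w y, inner_neg_right] at b2
  have l1' := abs_le.mp l1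
  have l2' := abs_le.mp l2
  rw [abs_le]
  constructor <;> linarith

theorem c11_regularity_on_strain {n : ℕ} (u : EuclideanSpace ℝ (Fin n) → ℝ)
    (hu : LipschitzWith 1 u) (ε₀ : ℝ) (hε₀ : 0 < ε₀) :
    (∀ x ∈ strainEps u ε₀, DifferentiableAt ℝ u x) ∧
    ∃ v : EuclideanSpace ℝ (Fin n) → ℝ,
      ContDiff ℝ 1 v ∧ LocallyLipschitz (gradient v) ∧
      ∀ x ∈ strainEps u ε₀, v x = u x ∧ gradient v x = gradient u x := by
  choose! p hp using c11_strain u hu ε₀ hε₀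
  have hK : 0 ≤ 1 / (2 * ε₀) := by positivity
  have hgu : ∀ x ∈ strainEps u ε₀, HasGradientAt u (p x) x := fun x hx =>
    c11_hasGradientAt_of_quad (M := 1 / (2 * ε₀)) fun d => by simpa using hp x hx (x + d)
  refine ⟨fun x hx => (hgu x hx).differentiableAt, ?_⟩
  obtain ⟨v, hv, hvS⟩ := c11_extension hK hp
  obtain ⟨h1, h2⟩ := c11_of_quad (by positivity) hv
  refine ⟨v, h1, h2, fun x hx => ⟨(hvS x hx).1, ?_⟩⟩
  have hgv : HasGradientAt v (p x) x :=
    c11_hasGradientAt_of_quad (M := 1 / (2 * ε₀)) fun d => by simpa using (hvS x hx).2 (x + d)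
  rw [hgv.gradient, (hgu x hx).gradient]
end

section
/- Let u : ℝⁿ → ℝ be 1-Lipschitz and let Strain[u] ⊆ ℝⁿ be its set of strain points. Then the relation defined on Strain[u] by x ∼ y if and only if |u(x) − u(y)| = ‖x − y‖ is an equivalence relation on Strain[u]; in particular it is transitive: if x, y, z ∈ Strain[u] with |u(x) − u(y)| = ‖x−y‖ and |u(y) − u(z)| = ‖y−z‖, then |u(x) − u(z)| = ‖x−z‖. -/
/-- The strain set of a function `u` on `ℝⁿ`. -/
def strainSet {n : ℕ} (u : EuclideanSpace ℝ (Fin n) → ℝ) :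
    Set (EuclideanSpace ℝ (Fin n)) :=
  {y | ∃ x z : EuclideanSpace ℝ (Fin n), u y - u x = ‖x - y‖ ∧ 0 < ‖x - y‖ ∧
    u z - u y = ‖y - z‖ ∧ 0 < ‖y - z‖ ∧ ‖x - z‖ = ‖x - y‖ + ‖y - z‖}

theorem strain_aux {E : Type*} [NormedAddCommGroup E] [InnerProductSpace ℝ E] (v : E → ℝ)
    (hv : ∀ p q, v p - v q ≤ ‖p - q‖) (a x y z : E) (ha : v y - v a = ‖y - a‖)
    (hpos : 0 < ‖y - a‖) (hx : v x - v y = ‖x - y‖) (hz : v z - v y = ‖z - y‖) :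
    |v x - v z| = ‖x - z‖ := by
  have key : ∀ w, v w - v y = ‖w - y‖ → SameRay ℝ (w - y) (y - a) := by
    intro w hw
    rw [sameRay_iff_norm_add]
    apply le_antisymm (norm_add_le _ _)
    have h := hv w a
    rw [sub_add_sub_cancel]
    linarith
  have hne : y - a ≠ 0 := norm_pos_iff.1 hpos
  have h : SameRay ℝ (x - y) (z - y) :=
    (key x hx).trans (key z hz).symm (fun h => absurd h hne)
  have h2 := h.norm_sub
  rw [sub_sub_sub_cancel_right] at h2
  rw [h2, ← hx, ← hz]
  congr 1
  ring

/-- On the strain set of a `1`-Lipschitz `u : ℝⁿ → ℝ`, the relation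
`x ∼ y ↔ |u x - u y| = ‖x - y‖` is an equivalence relation (it is reflexive, symmetric,
and — the nontrivial part — transitive). -/
theorem strain_rel_equivalence {n : ℕ} (u : EuclideanSpace ℝ (Fin n) → ℝ)
    (hu : LipschitzWith 1 u) :
    (∀ x ∈ strainSet u, |u x - u x| = ‖x - x‖) ∧
    (∀ x ∈ strainSet u, ∀ y ∈ strainSet u,
      |u x - u y| = ‖x - y‖ → |u y - u x| = ‖y - x‖) ∧
    (∀ x ∈ strainSet u, ∀ y ∈ strainSet u, ∀ z ∈ strainSet u,
      |u x - u y| = ‖x - y‖ → |u y - u z| = ‖y - z‖ → |u x - u z| = ‖x - z‖) := by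
  have hv : ∀ p q, u p - u q ≤ ‖p - q‖ := by
    intro p q
    have h := hu.dist_le_mul p q
    rw [Real.dist_eq, dist_eq_norm] at h
    simp only [NNReal.coe_one, one_mul] at h
    exact (le_abs_self _).trans h
  refine ⟨fun x _ => by simp, fun x _ y _ h => by rw [abs_sub_comm, h, norm_sub_rev], ?_⟩
  rintro x - y ⟨a, b, ha, hap, hb, hbp, -⟩ z - hxy hyz
  have tri := norm_sub_le_norm_sub_add_norm_sub x y z
  have h1 := hv x z
  have h2 := hv z x
  rw [norm_sub_rev z x] at h2
  have hyz' := norm_sub_rev y z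
  rcases abs_cases (u x - u y) with ⟨e1, -⟩ | ⟨e1, -⟩ <;>
    rcases abs_cases (u y - u z) with ⟨e2, -⟩ | ⟨e2, -⟩
  · refine le_antisymm (abs_le.2 ⟨by linarith, h1⟩) (le_trans ?_ (le_abs_self _))
    linarith
  · rw [norm_sub_rev] at ha hap
    exact strain_aux u hv a x y z ha hap (by linarith) (by linarith)
  · have h := strain_aux (fun p => - u p)
      (fun p q => by have := hv q p; rw [norm_sub_rev] at this; linarith) b x y z
      (by linarith) hbp (by linarith) (by linarith)
    rw [← h, ← abs_neg]
    congr 1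
    ring
  · refine le_antisymm (abs_le.2 ⟨by linarith, h1⟩) (le_trans ?_ (neg_le_abs _))
    linarith
end
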